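/- arXiv:math/0310394 — 3 statements merged into one kernel-verified Lean document; each statement's English description precedes it below -/
import Mathlib

section
/- Let m, p be coprime integers with m ≥ 2 and p ≥ 2, and let z ∈ ℂ be such that 2z+1 is not a non-zero integer. Set Ω = ℂ \ (−∞, −π²/(mp)]. Then: (i) Φ_{m,p,z} is analytic on Ω; (ii) I_{m,p,z}(x) = (1/(2√π)) ∫_0^1 (t(1−t))^{−1/2} Φ_{m,p,z}(tx) dt defines an analytic function on Ω; (iii) the convolution (H_{m,p} * I_{m,p,z})(x) = x ∫_0^1 H_{m,p}((1−t)x) I_{m,p,z}(tx) dt is analytic on Ω; and (iv) for every θ ∈ (−π, π) there exists a constant A_θ > 0 such that |(H_{m,p} * I_{m,p,z})(x)| ≤ A_θ · e^{|x|/π} for all x on the ray e^{iθ}·[0,∞). -/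
open Complex Filter MeasureTheory Metric Set Topology
open scoped Real Nat Classical

/-- The meromorphic function `F_{m,p,z}` of the paper, with the convention that
`sinh((2z+1)√(mp)x)/(2z+1)` is interpreted as its limit `√(mp)x` when `2z+1 = 0`. -/
noncomputable def Fmpz (m p : ℕ) (z x : ℂ) : ℂ :=
  ((if 2 * z + 1 = 0 then ((Real.sqrt ((m : ℝ) * (p : ℝ)) : ℂ) * x)
      else Complex.sinh ((2 * z + 1) * (Real.sqrt ((m : ℝ) * (p : ℝ)) : ℂ) * x) / (2 * z + 1))
    * Complex.sinh ((Real.sqrt ((m : ℝ) / (p : ℝ)) : ℂ) * x)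
    * Complex.sinh ((Real.sqrt ((p : ℝ) / (m : ℝ)) : ℂ) * x))
    / Complex.sinh ((Real.sqrt ((m : ℝ) * (p : ℝ)) : ℂ) * x)

/-- Since `F_{m,p,z}` is even, `Φ_{m,p,z}(ξ) = F_{m,p,z}(s)` for any `s` with `s² = ξ`
is well defined; we realise it using the principal square root `ξ^(1/2)`. -/
noncomputable def Phimpz (m p : ℕ) (z ξ : ℂ) : ℂ :=
  Fmpz m p z (ξ ^ ((1 : ℂ) / 2))

/-- `I_{m,p,z}(x) = (1/(2√π)) ∫_0^1 (t(1-t))^{-1/2} Φ_{m,p,z}(tx) dt`. -/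
noncomputable def Impz (m p : ℕ) (z x : ℂ) : ℂ :=
  (1 / (2 * ((Real.sqrt Real.pi : ℝ) : ℂ))) *
    ∫ t in (0:ℝ)..1, ((Real.sqrt (t * (1 - t)) : ℝ) : ℂ)⁻¹ * Phimpz m p z ((t : ℂ) * x)

/-- The convolution `(f*g)(x) = ∫_0^x f(x-ξ)g(ξ)dξ = x ∫_0^1 f((1-t)x) g(tx) dt`. -/
noncomputable def convBorel (f g : ℂ → ℂ) (x : ℂ) : ℂ :=
  x * ∫ t in (0:ℝ)..1, f ((1 - (t : ℂ)) * x) * g ((t : ℂ) * x)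

/-- The cut plane `Ω = ℂ \ (-∞, -π²/(mp)]`. -/
def Omg (m p : ℕ) : Set ℂ :=
  {x : ℂ | ¬ (x.im = 0 ∧ x.re ≤ -(Real.pi ^ 2 / ((m : ℝ) * (p : ℝ))))}

/-! ### Bounds and zeros of the hyperbolic sine -/

lemma Complex.norm_sinh_le_exp_norm (w : ℂ) : ‖Complex.sinh w‖ ≤ Real.exp ‖w‖ := by
  have h1 := Complex.norm_exp_le_exp_norm w
  have h2 := Complex.norm_exp_le_exp_norm (-w)
  rw [norm_neg] at h2
  have h3 := norm_sub_le (Complex.exp w) (Complex.exp (-w))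
  rw [Complex.sinh, norm_div, Complex.norm_ofNat]
  linarith

lemma Complex.norm_sinh_le_norm_mul_exp_norm (w : ℂ) :
    ‖Complex.sinh w‖ ≤ ‖w‖ * Real.exp ‖w‖ := by
  have h1 := Complex.norm_exp_sub_sum_le_norm_mul_exp w 1
  have h2 := Complex.norm_exp_sub_sum_le_norm_mul_exp (-w) 1
  simp only [Finset.range_one, Finset.sum_singleton, pow_zero, Nat.factorial_zero, Nat.cast_one,
    div_one, pow_one, norm_neg] at h1 h2
  have h3 := norm_sub_le (Complex.exp w - 1) (Complex.exp (-w) - 1)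
  rw [sub_sub_sub_cancel_right] at h3
  rw [Complex.sinh, norm_div, Complex.norm_ofNat]
  linarith

lemma Complex.sinh_re_le_norm_sinh (w : ℂ) : Real.sinh w.re ≤ ‖Complex.sinh w‖ := by
  have h := norm_sub_norm_le (Complex.exp w) (Complex.exp (-w))
  rw [Complex.norm_exp, Complex.norm_exp, Complex.neg_re] at h
  rw [Complex.sinh, norm_div, Complex.norm_ofNat, Real.sinh_eq]
  linarith

lemma Complex.exists_int_sq_eq_of_sinh_eq_zero {w : ℂ} (hw : Complex.sinh w = 0) :
    ∃ k : ℤ, w ^ 2 = -((k : ℂ) ^ 2 * (π : ℂ) ^ 2) := by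
  have h : Complex.sin (w * I) = 0 := by rw [Complex.sin_mul_I, hw, zero_mul]
  obtain ⟨k, hk⟩ := Complex.sin_eq_zero_iff.1 h
  refine ⟨k, ?_⟩
  have h2 : (w * I) ^ 2 = ((k : ℂ) * π) ^ 2 := by rw [hk]
  rw [mul_pow, I_sq] at h2
  linear_combination -h2

/-! ### The cut plane -/

lemma isOpen_Omg (m p : ℕ) : IsOpen (Omg m p) := by
  have : IsClosed {x : ℂ | x.im = 0 ∧ x.re ≤ -(Real.pi ^ 2 / ((m : ℝ) * (p : ℝ)))} :=
    (isClosed_eq Complex.continuous_im continuous_const).inter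
      (isClosed_le Complex.continuous_re continuous_const)
  exact this.isOpen_compl

lemma ofReal_mul_mem_Omg {m p : ℕ} (hm : 0 < m) (hp : 0 < p) {x : ℂ} (hx : x ∈ Omg m p) {t : ℝ}
    (ht : t ∈ Icc (0 : ℝ) 1) : (t : ℂ) * x ∈ Omg m p := by
  have hL : 0 < Real.pi ^ 2 / ((m : ℝ) * (p : ℝ)) := by positivity
  rintro ⟨h1, h2⟩
  rw [Complex.im_ofReal_mul] at h1
  rw [Complex.re_ofReal_mul] at h2
  have ht0 : t ≠ 0 := by rintro rfl; linarith
  have htp : 0 < t := lt_of_le_of_ne ht.1 ht0.symm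
  refine hx ⟨(mul_eq_zero.1 h1).resolve_left ht0, ?_⟩
  by_contra! h
  nlinarith [ht.2]

lemma sinh_ne_zero_of_sq_mem_Omg {m p : ℕ} (hm : 0 < m) (hp : 0 < p) {s : ℂ} (hs : s ≠ 0)
    (h : s ^ 2 ∈ Omg m p) :
    Complex.sinh ((Real.sqrt ((m : ℝ) * (p : ℝ)) : ℂ) * s) ≠ 0 := by
  intro h0
  have hmp : 0 < (m : ℝ) * p := by positivity
  obtain ⟨k, hk⟩ := Complex.exists_int_sq_eq_of_sinh_eq_zero h0
  rw [mul_pow, ← Complex.ofReal_pow, Real.sq_sqrt hmp.le] at hk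
  have hs2 : s ^ 2 = ((-((k : ℝ) ^ 2 * π ^ 2 / ((m : ℝ) * p)) : ℝ) : ℂ) := by
    have hmp' : (((m : ℝ) * p : ℝ) : ℂ) ≠ 0 := by exact_mod_cast hmp.ne'
    rw [Complex.ofReal_neg, Complex.ofReal_div, ← neg_div, eq_div_iff hmp', mul_comm, hk]
    push_cast
    ring
  have hk0 : k ≠ 0 := by
    rintro rfl
    apply hs
    simpa using hs2
  have hk1 : (1 : ℝ) ≤ (k : ℝ) ^ 2 := by
    exact_mod_cast Int.one_le_abs (pow_ne_zero 2 hk0) |>.trans_eq (abs_of_nonneg (sq_nonneg k))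
  rw [hs2] at h
  refine h ⟨Complex.ofReal_im _, ?_⟩
  rw [Complex.ofReal_re, neg_le_neg_iff]
  gcongr
  nlinarith [sq_nonneg π]

/-! ### The function `Fmpz` -/

lemma Fmpz_zero (m p : ℕ) (z : ℂ) : Fmpz m p z 0 = 0 := by
  simp [Fmpz]

lemma Fmpz_neg (m p : ℕ) (z x : ℂ) : Fmpz m p z (-x) = Fmpz m p z x := by
  unfold Fmpz
  simp only [mul_neg, Complex.sinh_neg, neg_div, div_neg, neg_mul, neg_neg]
  split_ifs <;> simp [neg_div]

lemma Phimpz_sq (m p : ℕ) (z s : ℂ) : Phimpz m p z (s ^ 2) = Fmpz m p z s := by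
  have h : ((s ^ 2) ^ ((1 : ℂ) / 2)) ^ 2 = s ^ 2 := by
    rw [← Complex.cpow_nat_mul]; norm_num
  unfold Phimpz
  rcases sq_eq_sq_iff_eq_or_eq_neg.1 h with h | h
  · rw [h]
  · rw [h, Fmpz_neg]

/-- The first factor in the numerator of `Fmpz`. -/
noncomputable def colouredFactor (m p : ℕ) (z x : ℂ) : ℂ :=
  if 2 * z + 1 = 0 then ((Real.sqrt ((m : ℝ) * (p : ℝ)) : ℂ) * x)
    else Complex.sinh ((2 * z + 1) * (Real.sqrt ((m : ℝ) * (p : ℝ)) : ℂ) * x) / (2 * z + 1)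

lemma differentiable_colouredFactor (m p : ℕ) (z : ℂ) :
    Differentiable ℂ (colouredFactor m p z) := by
  unfold colouredFactor
  split_ifs <;> fun_prop

lemma exists_norm_colouredFactor_le (m p : ℕ) (z : ℂ) :
    ∃ C K : ℝ, 0 ≤ C ∧ 0 ≤ K ∧ ∀ x, ‖colouredFactor m p z x‖ ≤ C * Real.exp (K * ‖x‖) := by
  by_cases hz : 2 * z + 1 = 0
  · refine ⟨Real.sqrt (m * p), 1, by positivity, by positivity, fun x => ?_⟩
    rw [colouredFactor, if_pos hz, norm_mul, Complex.norm_real, Real.norm_of_nonneg (by positivity),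
      one_mul]
    gcongr
    linarith [Real.add_one_le_exp ‖x‖]
  · refine ⟨‖2 * z + 1‖⁻¹, ‖2 * z + 1‖ * Real.sqrt (m * p), by positivity, by positivity,
      fun x => ?_⟩
    rw [colouredFactor, if_neg hz, norm_div, div_eq_inv_mul]
    gcongr
    refine (Complex.norm_sinh_le_exp_norm _).trans_eq ?_
    rw [norm_mul, norm_mul, Complex.norm_real, Real.norm_of_nonneg (by positivity)]

lemma differentiableAt_Fmpz {m p : ℕ} (hm : 0 < m) (hp : 0 < p) (z : ℂ) {s : ℂ}
    (hs : s ^ 2 ∈ Omg m p) : DifferentiableAt ℂ (Fmpz m p z) s := by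
  set a : ℂ := (Real.sqrt ((m : ℝ) * (p : ℝ)) : ℂ) with ha
  have ha0 : a ≠ 0 := by
    have : 0 < Real.sqrt ((m : ℝ) * (p : ℝ)) := by positivity
    exact Complex.ofReal_ne_zero.2 this.ne'
  have hsinh : ∀ b : ℂ, Differentiable ℂ (dslope (fun x => Complex.sinh (b * x)) 0) := fun b => by
    rw [← differentiableOn_univ, Complex.differentiableOn_dslope Filter.univ_mem, differentiableOn_univ]
    fun_prop
  have hmul : ∀ b x : ℂ, Complex.sinh (b * x) = x * dslope (fun x => Complex.sinh (b * x)) 0 x :=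
    fun b x => by simpa using (sub_smul_dslope (fun x => Complex.sinh (b * x)) 0 x).symm
  have hF : Fmpz m p z = fun x => colouredFactor m p z x
      * dslope (fun x => Complex.sinh ((Real.sqrt ((m : ℝ) / (p : ℝ)) : ℂ) * x)) 0 x
      * Complex.sinh ((Real.sqrt ((p : ℝ) / (m : ℝ)) : ℂ) * x)
      / dslope (fun x => Complex.sinh (a * x)) 0 x := by
    funext x
    by_cases hx : x = 0
    · subst hx
      simp [Fmpz_zero]
    · unfold Fmpz
      rw [hmul (Real.sqrt ((m : ℝ) / (p : ℝ)) : ℂ) x, ← ha, hmul a x, ← colouredFactor]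
      rw [← mul_div_mul_left _ (dslope (fun x => Complex.sinh (a * x)) 0 x) hx]
      congr 1
      ring
  have hden : dslope (fun x => Complex.sinh (a * x)) 0 s ≠ 0 := by
    by_cases h0 : s = 0
    · have hd : HasDerivAt (fun x => Complex.sinh (a * x)) a 0 := by
        simpa using ((hasDerivAt_id (0 : ℂ)).const_mul a).csinh
      rw [h0, dslope_same, hd.deriv]
      exact ha0
    · have := sinh_ne_zero_of_sq_mem_Omg hm hp h0 hs
      rw [← ha, hmul a s] at this
      exact right_ne_zero_of_mul this
  rw [hF]
  refine DifferentiableAt.div ?_ (hsinh a s) hden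
  refine ((differentiable_colouredFactor m p z s).mul (hsinh _ s)).mul ?_
  fun_prop

lemma analyticOnNhd_Phimpz {m p : ℕ} (hm : 0 < m) (hp : 0 < p) (z : ℂ) :
    AnalyticOnNhd ℂ (Phimpz m p z) (Omg m p) := by
  have hsq : ∀ ξ : ℂ, (ξ ^ ((1 : ℂ) / 2)) ^ 2 = ξ := fun ξ => by
    rw [← Complex.cpow_nat_mul]; norm_num
  have hdiff : ∀ ξ ∈ Omg m p, ξ ≠ 0 → DifferentiableAt ℂ (Phimpz m p z) ξ := by
    intro ξ hξ h0
    rcases Complex.mem_slitPlane_or_neg_mem_slitPlane h0 with h | h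
    · refine DifferentiableAt.comp (g := Fmpz m p z) ξ
        (differentiableAt_Fmpz hm hp z (by rwa [hsq])) ?_
      exact differentiableAt_id.cpow_const h
    · have hI : ∀ ξ : ℂ, (I * (-ξ) ^ ((1 : ℂ) / 2)) ^ 2 = ξ := fun ξ => by
        rw [mul_pow, hsq, I_sq]; ring
      have hP : Phimpz m p z = fun ξ => Fmpz m p z (I * (-ξ) ^ ((1 : ℂ) / 2)) := by
        funext ξ
        rw [← Phimpz_sq, hI]
      rw [hP]
      refine DifferentiableAt.comp (g := Fmpz m p z) ξ
        (differentiableAt_Fmpz hm hp z (by rwa [hI])) ?_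
      exact ((differentiableAt_id.neg).cpow_const h).const_mul I
  intro ξ hξ
  by_cases h0 : ξ = 0
  · subst h0
    refine Complex.analyticAt_of_differentiable_on_punctured_nhds_of_continuousAt ?_ ?_
    · filter_upwards [self_mem_nhdsWithin,
        mem_nhdsWithin_of_mem_nhds ((isOpen_Omg m p).mem_nhds hξ)] with x hx hx'
      exact hdiff x hx' hx
    · have h1 : ContinuousAt (fun ξ : ℂ => ξ ^ ((1 : ℂ) / 2)) 0 :=
        Complex.continuousAt_cpow_const_of_re_pos (by simp) (by norm_num)
      refine ContinuousAt.comp (g := Fmpz m p z) ?_ h1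
      exact (differentiableAt_Fmpz hm hp z (by rwa [hsq])).continuousAt
  · refine DifferentiableOn.analyticAt (s := Omg m p \ {0}) (fun x hx => ?_) ?_
    · exact (hdiff x hx.1 hx.2).differentiableWithinAt
    · exact ((isOpen_Omg m p).sdiff isClosed_singleton).mem_nhds ⟨hξ, h0⟩

lemma exists_norm_Phimpz_ray_le {m p : ℕ} (hm : 0 < m) (hp : 0 < p) (z : ℂ) {θ : ℝ}
    (hθ : θ ∈ Ioo (-π) π) :
    ∃ B : ℝ, 0 ≤ B ∧ ∀ r : ℝ, 0 ≤ r →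
      ‖Phimpz m p z ((r : ℂ) * Complex.exp (I * (θ : ℂ)))‖ ≤ B * Real.exp (r / 4) := by
  obtain ⟨C, K, hC, hK, hCK⟩ := exists_norm_colouredFactor_le m p z
  set a := Real.sqrt ((m : ℝ) * (p : ℝ)) with ha
  set b := Real.sqrt ((m : ℝ) / (p : ℝ)) with hb
  set d := Real.sqrt ((p : ℝ) / (m : ℝ)) with hd
  have ha0 : 0 < a := by positivity
  have hb0 : 0 < b := by positivity
  have hd0 : 0 < d := by positivity
  have hcos : 0 < Real.cos (θ / 2) :=
    Real.cos_pos_of_mem_Ioo ⟨by linarith [hθ.1], by linarith [hθ.2]⟩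
  refine ⟨C * b / (a * Real.cos (θ / 2)) * Real.exp ((K + b + d) ^ 2), by positivity,
    fun r hr => ?_⟩
  set u := Real.sqrt r with hu
  set s : ℂ := (u : ℂ) * Complex.exp (I * ((θ / 2 : ℝ) : ℂ)) with hs
  have hs2 : s ^ 2 = (r : ℂ) * Complex.exp (I * (θ : ℂ)) := by
    rw [hs, mul_pow, ← Complex.ofReal_pow, Real.sq_sqrt hr, ← Complex.exp_nat_mul]
    congr 2
    push_cast
    ring
  have hu0 : 0 ≤ u := Real.sqrt_nonneg r
  have hsn : ‖s‖ = u := by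
    rw [hs, norm_mul, mul_comm I, Complex.norm_exp_ofReal_mul_I, mul_one, Complex.norm_real,
      Real.norm_of_nonneg hu0]
  rw [← hs2, Phimpz_sq]
  rcases hu0.eq_or_lt with h0 | hupos
  · have : s = 0 := by rw [hs, ← h0]; simp
    rw [this, Fmpz_zero, norm_zero]
    positivity
  have hre : ((a : ℂ) * s).re = a * (u * Real.cos (θ / 2)) := by
    rw [hs, Complex.re_ofReal_mul, Complex.re_ofReal_mul, mul_comm I, Complex.exp_ofReal_mul_I_re]
  have hden : a * (u * Real.cos (θ / 2)) ≤ ‖Complex.sinh ((a : ℂ) * s)‖ := by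
    refine le_trans ?_ (Complex.sinh_re_le_norm_sinh _)
    rw [hre, Real.self_le_sinh_iff]
    positivity
  have h1 := hCK s
  have h2 : ‖Complex.sinh ((b : ℂ) * s)‖ ≤ b * u * Real.exp (b * u) := by
    have := Complex.norm_sinh_le_norm_mul_exp_norm ((b : ℂ) * s)
    rwa [norm_mul, Complex.norm_real, Real.norm_of_nonneg hb0.le, hsn] at this
  have h3 : ‖Complex.sinh ((d : ℂ) * s)‖ ≤ Real.exp (d * u) := by
    have := Complex.norm_sinh_le_exp_norm ((d : ℂ) * s)
    rwa [norm_mul, Complex.norm_real, Real.norm_of_nonneg hd0.le, hsn] at this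
  rw [hsn] at h1
  have hr2 : r = u ^ 2 := (Real.sq_sqrt hr).symm
  unfold Fmpz
  rw [← colouredFactor, norm_div, norm_mul, norm_mul, ← ha, ← hb, ← hd]
  calc _ ≤ (C * Real.exp (K * u)) * (b * u * Real.exp (b * u)) * Real.exp (d * u) /
        (a * (u * Real.cos (θ / 2))) := by gcongr
    _ = C * b / (a * Real.cos (θ / 2)) * Real.exp ((K + b + d) * u) := by
        rw [add_mul, add_mul, Real.exp_add, Real.exp_add]
        field_simp
    _ ≤ C * b / (a * Real.cos (θ / 2)) * Real.exp ((K + b + d) ^ 2 + r / 4) := by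
        gcongr
        nlinarith [sq_nonneg (K + b + d - u / 2)]
    _ = _ := by rw [Real.exp_add, mul_assoc]

/-! ### Holomorphic parametric integrals over the unit interval -/

lemma differentiableOn_integral_mul_of_hasDerivAt {w : ℝ → ℂ}
    (hw : IntervalIntegrable w volume 0 1) {U : Set ℂ} (hU : IsOpen U) {k k' : ℝ → ℂ → ℂ}
    (hk : ContinuousOn (Function.uncurry k) (Icc 0 1 ×ˢ U))
    (hk' : ContinuousOn (Function.uncurry k') (Icc 0 1 ×ˢ U))
    (hd : ∀ t ∈ Icc (0 : ℝ) 1, ∀ x ∈ U, HasDerivAt (k t) (k' t x) x) :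
    DifferentiableOn ℂ (fun x => ∫ t in (0 : ℝ)..1, w t * k t x) U := by
  intro x₀ hx₀
  obtain ⟨ε, hε, hball⟩ := Metric.nhds_basis_closedBall.mem_iff.1 (hU.mem_nhds hx₀)
  have hslice : ∀ {q : ℝ → ℂ → ℂ}, ContinuousOn (Function.uncurry q) (Icc 0 1 ×ˢ U) → ∀ x ∈ U,
      IntervalIntegrable (fun t => w t * q t x) volume 0 1 := by
    intro q hq x hx
    refine hw.mul_continuousOn ?_
    rw [uIcc_of_le zero_le_one]
    exact hq.comp (f := fun t : ℝ => (t, x)) (by fun_prop) fun t ht => ⟨ht, hx⟩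
  obtain ⟨M, hM⟩ := (isCompact_Icc.prod (isCompact_closedBall x₀ ε)).exists_bound_of_continuousOn
    (hk'.mono (prod_mono_right hball))
  have hIcc : ∀ {t : ℝ}, t ∈ uIoc (0 : ℝ) 1 → t ∈ Icc (0 : ℝ) 1 := fun {t} ht => by
    rw [uIoc_of_le zero_le_one] at ht
    exact Ioc_subset_Icc_self ht
  refine (intervalIntegral.hasDerivAt_integral_of_dominated_loc_of_deriv_le
    (F := fun x t => w t * k t x) (F' := fun x t => w t * k' t x) (bound := fun t => ‖w t‖ * M)
    (Metric.closedBall_mem_nhds x₀ hε) ?_ (hslice hk x₀ hx₀) (hslice hk' x₀ hx₀).def'.1 ?_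
    (hw.norm.mul_const M) ?_).2.differentiableAt.differentiableWithinAt
  · filter_upwards [hU.mem_nhds hx₀] with x hx using (hslice hk x hx).def'.1
  · refine Eventually.of_forall fun t ht x hx => ?_
    rw [norm_mul]
    exact mul_le_mul_of_nonneg_left (hM (t, x) ⟨hIcc ht, hx⟩) (norm_nonneg _)
  · exact Eventually.of_forall fun t ht x hx => (hd t (hIcc ht) x (hball hx)).const_mul (w t)

lemma differentiableOn_integral_mul_scaled {w : ℝ → ℂ}
    (hw : IntervalIntegrable w volume 0 1) {U : Set ℂ} (hU : IsOpen U)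
    (hstar : ∀ x ∈ U, ∀ t ∈ Icc (0 : ℝ) 1, (t : ℂ) * x ∈ U) {f g : ℂ → ℂ}
    (hf : DifferentiableOn ℂ f U) (hg : DifferentiableOn ℂ g U) :
    DifferentiableOn ℂ
      (fun x => ∫ t in (0 : ℝ)..1, w t * (f ((1 - (t : ℂ)) * x) * g ((t : ℂ) * x))) U := by
  have hstar' : ∀ x ∈ U, ∀ t ∈ Icc (0 : ℝ) 1, (1 - (t : ℂ)) * x ∈ U := fun x hx t ht => by
    have := hstar x hx (1 - t) ⟨by linarith [ht.2], by linarith [ht.1]⟩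
    rwa [Complex.ofReal_sub, Complex.ofReal_one] at this
  have hleft : ∀ {q : ℂ → ℂ}, ContinuousOn q U →
      ContinuousOn (fun y : ℝ × ℂ => q ((1 - (y.1 : ℂ)) * y.2)) (Icc 0 1 ×ˢ U) := fun hq =>
    hq.comp (f := fun y : ℝ × ℂ => (1 - (y.1 : ℂ)) * y.2) (by fun_prop)
      fun y hy => hstar' y.2 hy.2 y.1 hy.1
  have hright : ∀ {q : ℂ → ℂ}, ContinuousOn q U →
      ContinuousOn (fun y : ℝ × ℂ => q ((y.1 : ℂ) * y.2)) (Icc 0 1 ×ˢ U) := fun hq =>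
    hq.comp (f := fun y : ℝ × ℂ => (y.1 : ℂ) * y.2) (by fun_prop)
      fun y hy => hstar y.2 hy.2 y.1 hy.1
  have hf' := (hf.deriv hU).continuousOn
  have hg' := (hg.deriv hU).continuousOn
  refine differentiableOn_integral_mul_of_hasDerivAt hw hU
    (k := fun t x => f ((1 - (t : ℂ)) * x) * g ((t : ℂ) * x))
    (k' := fun t x => (deriv f ((1 - (t : ℂ)) * x) * (1 - (t : ℂ))) * g ((t : ℂ) * x) +
      f ((1 - (t : ℂ)) * x) * (deriv g ((t : ℂ) * x) * (t : ℂ))) ?_ ?_ fun t ht x hx => ?_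
  · exact (hleft hf.continuousOn).mul (hright hg.continuousOn)
  · refine (((hleft hf').mul ?_).mul (hright hg.continuousOn)).add
      ((hleft hf.continuousOn).mul ((hright hg').mul ?_)) <;> fun_prop
  · have h1 := (hf.differentiableAt (hU.mem_nhds (hstar' x hx t ht))).hasDerivAt
    have h2 := (hg.differentiableAt (hU.mem_nhds (hstar x hx t ht))).hasDerivAt
    refine HasDerivAt.mul ?_ ?_
    · exact h1.comp x (by simpa using (hasDerivAt_id x).const_mul (1 - (t : ℂ)))
    · exact h2.comp x (by simpa using (hasDerivAt_id x).const_mul (t : ℂ))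

lemma intervalIntegrable_inv_sqrt_mul_one_sub :
    IntervalIntegrable (fun t : ℝ => ((Real.sqrt (t * (1 - t)) : ℝ) : ℂ)⁻¹) volume 0 1 := by
  have h := Complex.betaIntegral_convergent (u := 1 / 2) (v := 1 / 2) (by norm_num) (by norm_num)
  refine h.congr_uIoo ?_
  rw [uIoo_of_le zero_le_one]
  intro t ht
  have h0 : 0 ≤ t := ht.1.le
  have h1 : 0 ≤ 1 - t := by linarith [ht.2]
  have hexp : (1 / 2 - 1 : ℂ) = ((-(1 / 2) : ℝ) : ℂ) := by push_cast; norm_num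
  have hsub : (1 - (t : ℂ)) = ((1 - t : ℝ) : ℂ) := by push_cast; rfl
  dsimp only
  rw [hexp, hsub, ← Complex.ofReal_cpow h0, ← Complex.ofReal_cpow h1, ← Complex.ofReal_mul,
    ← Real.mul_rpow h0 h1, Real.rpow_neg (mul_nonneg h0 h1), ← Real.sqrt_eq_rpow,
    Complex.ofReal_inv]

/-! ### Exponential type of the Borel transform of a power series -/

lemma differentiable_of_hasSum_pow {a : ℕ → ℂ} {H : ℂ → ℂ}
    (hH : ∀ ξ : ℂ, HasSum (fun n : ℕ => a n * ξ ^ n) (H ξ)) : Differentiable ℂ H := by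
  have hHeq : H = fun ξ => ∑' n : ℕ, a n * ξ ^ n := funext fun ξ => (hH ξ).tsum_eq.symm
  intro ξ
  have hs := (hH ((‖ξ‖ + 1 : ℝ) : ℂ)).summable.norm
  have hd : DifferentiableOn ℂ H (ball 0 (‖ξ‖ + 1)) := by
    rw [hHeq]
    refine Complex.differentiableOn_tsum_of_summable_norm hs (fun n => by fun_prop) isOpen_ball
      fun n w hw => ?_
    rw [mem_ball_zero_iff] at hw
    rw [norm_mul, norm_mul, norm_pow, norm_pow, Complex.norm_real,
      Real.norm_of_nonneg (by positivity)]
    gcongr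
  exact hd.differentiableAt (isOpen_ball.mem_nhds (by simp))

lemma exists_norm_le_exp_of_summable {c : ℕ → ℂ} {R : ℝ} (hR : 0 < R)
    (hc : Summable fun n : ℕ => c n * (R : ℂ) ^ n) {H : ℂ → ℂ}
    (hH : ∀ ξ : ℂ, HasSum (fun n : ℕ => c n / ((n.factorial : ℕ) : ℂ) * ξ ^ n) (H ξ)) :
    ∃ A : ℝ, 0 ≤ A ∧ ∀ ξ, ‖H ξ‖ ≤ A * Real.exp (‖ξ‖ / R) := by
  refine ⟨∑' n, ‖c n * (R : ℂ) ^ n‖, tsum_nonneg fun _ => norm_nonneg _, fun ξ => ?_⟩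
  have hexp : HasSum (fun n : ℕ => (‖ξ‖ / R) ^ n / n.factorial) (Real.exp (‖ξ‖ / R)) := by
    rw [Real.exp_eq_exp_ℝ]
    exact NormedSpace.expSeries_div_hasSum_exp _
  refine (hH ξ).norm_le_of_bounded (hexp.mul_left _) fun n => ?_
  have hle := hc.norm.le_tsum n fun _ _ => norm_nonneg _
  calc ‖c n / ((n.factorial : ℕ) : ℂ) * ξ ^ n‖
      = ‖c n * (R : ℂ) ^ n‖ * ((‖ξ‖ / R) ^ n / n.factorial) := by
        rw [norm_mul, norm_div, norm_mul, norm_pow, norm_pow, Complex.norm_natCast,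
          Complex.norm_real, Real.norm_of_nonneg hR.le, div_pow]
        field_simp
    _ ≤ _ := by gcongr

/-! ### The functions `Impz` and `convBorel` -/

lemma analyticOnNhd_Impz {m p : ℕ} (hm : 0 < m) (hp : 0 < p) (z : ℂ) :
    AnalyticOnNhd ℂ (Impz m p z) (Omg m p) := by
  refine DifferentiableOn.analyticOnNhd ?_ (isOpen_Omg m p)
  have h := differentiableOn_integral_mul_scaled intervalIntegrable_inv_sqrt_mul_one_sub
    (isOpen_Omg m p) (fun x hx t ht => ofReal_mul_mem_Omg hm hp hx ht) (f := fun _ => 1)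
    (differentiableOn_const 1) (analyticOnNhd_Phimpz hm hp z).differentiableOn
  simp only [one_mul] at h
  exact h.const_mul _

lemma analyticOnNhd_convBorel_Impz {m p : ℕ} (hm : 0 < m) (hp : 0 < p) (z : ℂ) {H : ℂ → ℂ}
    (hH : Differentiable ℂ H) :
    AnalyticOnNhd ℂ (convBorel H (Impz m p z)) (Omg m p) := by
  refine DifferentiableOn.analyticOnNhd ?_ (isOpen_Omg m p)
  have h := differentiableOn_integral_mul_scaled (w := fun _ => 1) intervalIntegrable_const
    (isOpen_Omg m p) (fun x hx t ht => ofReal_mul_mem_Omg hm hp hx ht)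
    hH.differentiableOn (analyticOnNhd_Impz hm hp z).differentiableOn
  simp only [one_mul] at h
  exact differentiableOn_id.mul h

lemma intervalIntegrable_Impz_integrand {m p : ℕ} (hm : 0 < m) (hp : 0 < p) (z : ℂ) {x : ℂ}
    (hx : x ∈ Omg m p) :
    IntervalIntegrable
      (fun t : ℝ => ((Real.sqrt (t * (1 - t)) : ℝ) : ℂ)⁻¹ * Phimpz m p z ((t : ℂ) * x))
      volume 0 1 := by
  refine intervalIntegrable_inv_sqrt_mul_one_sub.mul_continuousOn ?_
  rw [uIcc_of_le zero_le_one]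
  exact (analyticOnNhd_Phimpz hm hp z).continuousOn.comp (by fun_prop)
    fun t ht => ofReal_mul_mem_Omg hm hp hx ht

lemma exists_norm_Impz_ray_le {m p : ℕ} (hm : 0 < m) (hp : 0 < p) (z : ℂ) {θ : ℝ}
    (hθ : θ ∈ Ioo (-π) π) :
    ∃ B : ℝ, 0 ≤ B ∧ ∀ r : ℝ, 0 ≤ r →
      ‖Impz m p z ((r : ℂ) * Complex.exp (I * (θ : ℂ)))‖ ≤ B * Real.exp (r / 4) := by
  obtain ⟨B, hB, hΦ⟩ := exists_norm_Phimpz_ray_le hm hp z hθ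
  set w : ℝ → ℂ := fun t => ((Real.sqrt (t * (1 - t)) : ℝ) : ℂ)⁻¹ with hw
  have hwi : IntervalIntegrable w volume 0 1 := intervalIntegrable_inv_sqrt_mul_one_sub
  have hw0 : 0 ≤ ∫ t in (0 : ℝ)..1, ‖w t‖ :=
    intervalIntegral.integral_nonneg zero_le_one fun _ _ => norm_nonneg _
  set κ : ℂ := 1 / (2 * ((Real.sqrt Real.pi : ℝ) : ℂ)) with hκ
  refine ⟨‖κ‖ * ((∫ t in (0 : ℝ)..1, ‖w t‖) * B), by positivity, fun r hr => ?_⟩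
  rw [Impz, norm_mul, mul_assoc, mul_assoc, ← intervalIntegral.integral_mul_const]
  gcongr
  refine intervalIntegral.norm_integral_le_of_norm_le zero_le_one
    (Eventually.of_forall fun t ht => ?_) (hwi.norm.mul_const _)
  rw [norm_mul, ← mul_assoc, ← Complex.ofReal_mul]
  gcongr
  refine (hΦ (t * r) (mul_nonneg ht.1.le hr)).trans ?_
  gcongr
  nlinarith [ht.2]

lemma norm_convBorel_ray_le {f g : ℂ → ℂ} {A B δ θ r : ℝ} (hA : 0 ≤ A) (hr : 0 ≤ r)
    (hf : ∀ ξ, ‖f ξ‖ ≤ A * Real.exp (‖ξ‖ * δ))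
    (hg : ∀ r : ℝ, 0 ≤ r →
      ‖g ((r : ℂ) * Complex.exp (I * (θ : ℂ)))‖ ≤ B * Real.exp (r * δ)) :
    ‖convBorel f g ((r : ℂ) * Complex.exp (I * (θ : ℂ)))‖ ≤ A * B * (r * Real.exp (r * δ)) := by
  have hn : ‖(r : ℂ) * Complex.exp (I * (θ : ℂ))‖ = r := by
    rw [norm_mul, mul_comm I, Complex.norm_exp_ofReal_mul_I, mul_one, Complex.norm_real,
      Real.norm_of_nonneg hr]
  have hint := intervalIntegral.norm_integral_le_of_norm_le_const (a := (0 : ℝ)) (b := 1)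
    (C := A * B * Real.exp (r * δ))
    (f := fun t : ℝ => f ((1 - (t : ℂ)) * ((r : ℂ) * Complex.exp (I * (θ : ℂ)))) *
      g ((t : ℂ) * ((r : ℂ) * Complex.exp (I * (θ : ℂ))))) fun t ht => by
    rw [uIoc_of_le zero_le_one] at ht
    have h1 := hf ((1 - (t : ℂ)) * ((r : ℂ) * Complex.exp (I * (θ : ℂ))))
    have h2 := hg (t * r) (mul_nonneg ht.1.le hr)
    have ht' : ‖(1 - (t : ℂ))‖ = 1 - t := by
      rw [← Complex.ofReal_one, ← Complex.ofReal_sub, Complex.norm_real,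
        Real.norm_of_nonneg (by linarith [ht.2])]
    rw [norm_mul _ ((r : ℂ) * _), hn, ht'] at h1
    rw [Complex.ofReal_mul, mul_assoc] at h2
    rw [norm_mul]
    refine (mul_le_mul h1 h2 (norm_nonneg _) (by positivity)).trans_eq ?_
    rw [mul_mul_mul_comm, ← Real.exp_add]
    congr 2
    ring
  rw [sub_zero, abs_one, mul_one] at hint
  rw [convBorel, norm_mul, hn]
  calc _ ≤ r * (A * B * Real.exp (r * δ)) := by gcongr
    _ = _ := by ring

/-- Linear factors are absorbed by a slightly larger exponential rate. -/
lemma mul_exp_quarter_le (r : ℝ) :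
    r * Real.exp (r * 4⁻¹) ≤ (π⁻¹ - 4⁻¹)⁻¹ * Real.exp (r / π) := by
  have hpos : 0 < π⁻¹ - 4⁻¹ :=
    sub_pos.2 ((inv_lt_inv₀ (by norm_num) Real.pi_pos).2 Real.pi_lt_four)
  have h : r * (π⁻¹ - 4⁻¹) ≤ Real.exp (r * (π⁻¹ - 4⁻¹)) := by
    linarith [Real.add_one_le_exp (r * (π⁻¹ - 4⁻¹))]
  calc r * Real.exp (r * 4⁻¹)
      = (π⁻¹ - 4⁻¹)⁻¹ * ((r * (π⁻¹ - 4⁻¹)) * Real.exp (r * 4⁻¹)) := by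
        rw [mul_comm r (π⁻¹ - 4⁻¹), mul_assoc, inv_mul_cancel_left₀ hpos.ne']
    _ ≤ (π⁻¹ - 4⁻¹)⁻¹ * (Real.exp (r * (π⁻¹ - 4⁻¹)) * Real.exp (r * 4⁻¹)) := by gcongr
    _ = _ := by
      rw [← Real.exp_add]
      congr 2
      ring

/-- For `2z+1` not a non-zero integer: `Φ_{m,p,z}` and `I_{m,p,z}` are analytic on
`Ω = ℂ \ (-∞, -π²/(mp)]`, the convolution `H_{m,p} * I_{m,p,z}` (the analytic
continuation of the formal Borel transform of the `z`-coloured Jones series of the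
`(m,p)`-torus knot) is analytic on `Ω`, and it grows at most like `A_θ e^{|x|/π}`
along every ray `e^{iθ}[0,∞)` with `θ ∈ (-π, π)`. -/
theorem stmt13 (m p : ℕ) (hm : 2 ≤ m) (hp : 2 ≤ p) (hcop : Nat.Coprime m p)
    (z : ℂ) (hz : ¬ ∃ n : ℤ, n ≠ 0 ∧ 2 * z + 1 = (n : ℂ))
    (c : ℕ → ℂ)
    (hc : ∀ h : ℂ, ‖h‖ < 2 * Real.pi → h ≠ 0 →
      HasSum (fun n : ℕ => c n * h ^ n)
        ((1 / (2 * ((Real.sqrt Real.pi : ℝ) : ℂ))) * h *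
          Complex.exp (-(h / 4) * (((p : ℂ) / (m : ℂ)) + ((m : ℂ) / (p : ℂ)))) /
          Complex.sinh (h / 2)))
    (H : ℂ → ℂ)
    (hH : ∀ ξ : ℂ, HasSum (fun n : ℕ => c n / ((n.factorial : ℕ) : ℂ) * ξ ^ n) (H ξ)) :
    AnalyticOnNhd ℂ (Phimpz m p z) (Omg m p) ∧
    (∀ x ∈ Omg m p,
      IntervalIntegrable
        (fun t : ℝ => ((Real.sqrt (t * (1 - t)) : ℝ) : ℂ)⁻¹ * Phimpz m p z ((t : ℂ) * x))
        volume 0 1) ∧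
    AnalyticOnNhd ℂ (Impz m p z) (Omg m p) ∧
    AnalyticOnNhd ℂ (convBorel H (Impz m p z)) (Omg m p) ∧
    (∀ θ : ℝ, θ ∈ Set.Ioo (-Real.pi) Real.pi →
      ∃ A : ℝ, 0 < A ∧ ∀ r : ℝ, 0 ≤ r →
        ‖convBorel H (Impz m p z) ((r : ℂ) * Complex.exp (Complex.I * (θ : ℂ)))‖
          ≤ A * Real.exp (r / Real.pi)) := by
  have hm0 : 0 < m := by omega
  have hp0 : 0 < p := by omega
  refine ⟨analyticOnNhd_Phimpz hm0 hp0 z, fun x hx => intervalIntegrable_Impz_integrand hm0 hp0 z hx,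
    analyticOnNhd_Impz hm0 hp0 z,
    analyticOnNhd_convBorel_Impz hm0 hp0 z (differentiable_of_hasSum_pow hH), fun θ hθ => ?_⟩
  have h4 : ‖((4 : ℝ) : ℂ)‖ < 2 * Real.pi := by
    rw [Complex.norm_real, Real.norm_of_nonneg (by norm_num)]
    linarith [Real.pi_gt_three]
  obtain ⟨A, hA, hHA⟩ := exists_norm_le_exp_of_summable (by norm_num)
    (hc ((4 : ℝ) : ℂ) h4 (by norm_num)).summable hH
  obtain ⟨B, hB, hIB⟩ := exists_norm_Impz_ray_le hm0 hp0 z hθ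
  have hpos : 0 < π⁻¹ - 4⁻¹ :=
    sub_pos.2 ((inv_lt_inv₀ (by norm_num) Real.pi_pos).2 Real.pi_lt_four)
  refine ⟨A * B * (π⁻¹ - 4⁻¹)⁻¹ + 1, by positivity, fun r hr => ?_⟩
  calc _ ≤ A * B * (r * Real.exp (r * 4⁻¹)) := norm_convBorel_ray_le hA hr hHA hIB
    _ ≤ A * B * ((π⁻¹ - 4⁻¹)⁻¹ * Real.exp (r / π)) :=
      mul_le_mul_of_nonneg_left (mul_exp_quarter_le r) (mul_nonneg hA hB)
    _ ≤ _ := by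
      rw [← mul_assoc]
      gcongr
      linarith
end

section
/- Let m ≥ 1 and let c : {1,…,m} → {1/2, 1} with c_1 = 1/2. For each i let B_i = #{ j ≤ i : c_j = 1/2 }, and let B = B_m be the total number of indices with c-value 1/2. Then the integral ∫_{0 < t_1 < t_2 < … < t_m < 1} ∏_{i=1}^m t_i^{−c_i} dt_1 … dt_m converges and equals 2^m · (1/B!) · ∏_{i : c_i = 1} (1/B_i). -/
open MeasureTheory Finset
open scoped Classical

theorem Fin.prod_card_filter_Iic {n : ℕ} (p : Fin n → Prop) [DecidablePred p] :
    ∏ i ∈ univ.filter p, ((Iic i).filter p).card = (univ.filter p).card.factorial := by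
  induction n with
  | zero => simp
  | succ n ih =>
    have h := ih fun i => p i.castSucc
    simp only [Finset.prod_filter, Finset.card_filter] at h ⊢
    have hlast : Iic (Fin.last n) = univ := by ext; simp [Fin.le_last]
    simp only [Fin.prod_univ_castSucc, Fin.sum_Iic_castSucc, h, hlast, Fin.sum_univ_castSucc]
    by_cases hp : p (Fin.last n)
    · simp [hp, Nat.factorial_succ, mul_comm]
    · simp [hp]

/-- The increasing tuples with all entries strictly between `0` and `x`. -/
def openOrderedSimplex (n : ℕ) (x : ℝ) : Set (Fin n → ℝ) :=
  {t | StrictMono t ∧ (∀ i, 0 < t i) ∧ ∀ i, t i < x}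

theorem measurableSet_openOrderedSimplex (n : ℕ) (x : ℝ) :
    MeasurableSet (openOrderedSimplex n x) := by
  unfold openOrderedSimplex StrictMono
  measurability

theorem snoc_mem_openOrderedSimplex {n : ℕ} {x y : ℝ} {t : Fin n → ℝ} :
    (Fin.snoc t y : Fin (n + 1) → ℝ) ∈ openOrderedSimplex (n + 1) x ↔
      y ∈ Set.Ioo 0 x ∧ t ∈ openOrderedSimplex n y := by
  simp only [openOrderedSimplex, Set.mem_ofPred_eq, Fin.forall_fin_succ', Fin.snoc_castSucc,
    Fin.snoc_last, Set.mem_Ioo]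
  constructor
  · rintro ⟨hm, ⟨h0, hy0⟩, -, hyx⟩
    refine ⟨⟨hy0, hyx⟩, fun i j hij => ?_, h0, fun i => ?_⟩
    · simpa using hm (Fin.castSucc_lt_castSucc_iff.2 hij)
    · simpa using hm (Fin.castSucc_lt_last i)
  · rintro ⟨⟨hy0, hyx⟩, hm, h0, hy⟩
    refine ⟨fun i j => ?_, ⟨h0, hy0⟩, fun i => (hy i).trans hyx, hyx⟩
    induction i using Fin.lastCases with
    | last => exact fun h => absurd h (Fin.le_last j).not_gt
    | cast i =>
      induction j using Fin.lastCases with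
      | last => simpa using hy i
      | cast j => simpa using @hm i j

theorem measurable_prod_rpow {n : ℕ} (c : Fin n → ℝ) :
    Measurable fun t : Fin n → ℝ => ∏ i, t i ^ (-(c i)) := by
  fun_prop

theorem lintegral_rpow_Ioo {x r : ℝ} (hx : 0 < x) (hr : -1 < r) :
    ∫⁻ y in Set.Ioo 0 x, ENNReal.ofReal (y ^ r) = ENNReal.ofReal (x ^ (r + 1) / (r + 1)) := by
  have hint : IntegrableOn (fun y : ℝ => y ^ r) (Set.Ioc 0 x) :=
    (intervalIntegrable_iff_integrableOn_Ioc_of_le hx.le).1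
      (intervalIntegral.intervalIntegrable_rpow' hr)
  rw [restrict_Ioo_eq_restrict_Ioc, ← ofReal_integral_eq_lintegral_ofReal hint ?_,
    ← intervalIntegral.integral_of_le hx.le, integral_rpow (Or.inl hr),
    Real.zero_rpow (by linarith), sub_zero]
  filter_upwards [ae_restrict_mem measurableSet_Ioc] with y hy
  exact Real.rpow_nonneg hy.1.le r

theorem lintegral_openOrderedSimplex_succ {n : ℕ} (x : ℝ) {f : (Fin (n + 1) → ℝ) → ENNReal}
    (hf : Measurable f) :
    ∫⁻ t in openOrderedSimplex (n + 1) x, f t =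
      ∫⁻ y in Set.Ioo 0 x, ∫⁻ t in openOrderedSimplex n y, f (Fin.snoc t y) := by
  have hS := measurableSet_openOrderedSimplex
  have hmp := (volume_preserving_piFinSuccAbove (fun _ : Fin (n + 1) => ℝ) (Fin.last n)).symm
  have he := (MeasurableEquiv.piFinSuccAbove (fun _ : Fin (n + 1) => ℝ)
    (Fin.last n)).symm.measurableEmbedding
  rw [← lintegral_indicator (hS _ _), ← lintegral_indicator measurableSet_Ioo,
    ← hmp.lintegral_comp_emb he, Measure.volume_eq_prod, lintegral_prod]
  swap
  · exact ((hf.indicator (hS _ _)).comp he.measurable).aemeasurable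
  refine lintegral_congr fun y => ?_
  have hsnoc (t : Fin n → ℝ) : (MeasurableEquiv.piFinSuccAbove (fun _ : Fin (n + 1) => ℝ)
      (Fin.last n)).symm (y, t) = Fin.snoc t y := by
    simp [MeasurableEquiv.piFinSuccAbove, Fin.insertNthEquiv]
  by_cases hy : y ∈ Set.Ioo 0 x
  · rw [Set.indicator_of_mem hy, ← lintegral_indicator (hS _ _)]
    refine lintegral_congr fun t => ?_
    simp only [hsnoc, Set.indicator_apply, snoc_mem_openOrderedSimplex, hy, true_and]
  · simp [hsnoc, snoc_mem_openOrderedSimplex, hy]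

theorem lintegral_prod_rpow_openOrderedSimplex {n : ℕ} (c : Fin n → ℝ)
    (hc : ∀ i, 0 < ∑ j ∈ Iic i, (1 - c j)) {x : ℝ} (hx : 0 < x) :
    ∫⁻ t in openOrderedSimplex n x, ENNReal.ofReal (∏ i, t i ^ (-(c i))) =
      ENNReal.ofReal (x ^ (∑ i, (1 - c i)) * ∏ i, (∑ j ∈ Iic i, (1 - c j))⁻¹) := by
  induction n generalizing x with
  | zero =>
    have h : openOrderedSimplex 0 x = Set.univ := by
      ext t
      simp [openOrderedSimplex, Subsingleton.strictMono]
    simp [h, volume_pi]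
  | succ n ih =>
    have hlast : Iic (Fin.last n) = univ := by ext; simp [Fin.le_last]
    have hpos := hc (Fin.last n)
    rw [hlast, Fin.sum_univ_castSucc] at hpos
    have ih' := @ih (fun i => c i.castSucc) fun i => by
      simpa [Fin.sum_Iic_castSucc] using hc i.castSucc
    simp only [Fin.prod_univ_castSucc, Fin.sum_Iic_castSucc, hlast, Fin.sum_univ_castSucc]
    rw [lintegral_openOrderedSimplex_succ x (by fun_prop)]
    simp only [Fin.snoc_castSucc, Fin.snoc_last]
    set s := ∑ i : Fin n, (1 - c i.castSucc)
    set K := ∏ i : Fin n, (∑ j ∈ Iic i, (1 - c j.castSucc))⁻¹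
    have hK : 0 ≤ K := prod_nonneg fun i _ => inv_nonneg.2 <| by
      simpa [Fin.sum_Iic_castSucc] using (hc i.castSucc).le
    have hinner : ∀ y ∈ Set.Ioo 0 x, ∫⁻ t in openOrderedSimplex n y,
        ENNReal.ofReal ((∏ i, t i ^ (-(c (Fin.castSucc i)))) * y ^ (-(c (Fin.last n)))) =
        ENNReal.ofReal K * ENNReal.ofReal (y ^ (s - c (Fin.last n))) := by
      intro y hy
      have hy0 := hy.1
      simp_rw [ENNReal.ofReal_mul' (Real.rpow_nonneg hy0.le _)]
      rw [lintegral_mul_const _ (measurable_prod_rpow _).ennreal_ofReal, ih' hy0,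
        ← ENNReal.ofReal_mul' (Real.rpow_nonneg hy0.le _), ← ENNReal.ofReal_mul hK,
        sub_eq_add_neg, Real.rpow_add hy0]
      congr 1
      ring
    rw [setLIntegral_congr_fun measurableSet_Ioo hinner, lintegral_const_mul _ (by fun_prop),
      lintegral_rpow_Ioo hx (by linarith), ← ENNReal.ofReal_mul hK,
      show s - c (Fin.last n) + 1 = s + (1 - c (Fin.last n)) by ring]
    congr 1
    ring

/-- For exponents `c : {1,…,m} → {1/2, 1}` with `c_1 = 1/2`, with `B_i` the number of
indices `j ≤ i` with `c_j = 1/2` and `B` the total number of such indices,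
`∫_{0 < t_1 < … < t_m < 1} ∏_i t_i^{-c_i} dt = 2^m (1/B!) ∏_{i : c_i = 1} (1/B_i)`,
the integral over the open simplex converging. -/
theorem stmt17 (m : ℕ) (hm : 1 ≤ m) (c : Fin m → ℝ)
    (hc : ∀ i, c i = 1 / 2 ∨ c i = 1) (hc1 : c ⟨0, hm⟩ = 1 / 2) :
    IntegrableOn (fun t : Fin m → ℝ => ∏ i, (t i) ^ (-(c i)))
      {t : Fin m → ℝ | StrictMono t ∧ (∀ i, 0 < t i) ∧ ∀ i, t i < 1} volume ∧
    ∫ t in {t : Fin m → ℝ | StrictMono t ∧ (∀ i, 0 < t i) ∧ ∀ i, t i < 1},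
        ∏ i, (t i) ^ (-(c i))
      = 2 ^ m *
        (1 / (((Finset.univ.filter fun j : Fin m => c j = 1 / 2).card.factorial : ℕ) : ℝ)) *
        ∏ i ∈ Finset.univ.filter fun i : Fin m => c i = 1,
          (1 / ((((Finset.Iic i).filter fun j : Fin m => c j = 1 / 2).card : ℕ) : ℝ)) := by
  have hsum (i : Fin m) : ∑ j ∈ Iic i, (1 - c j) =
      (((Iic i).filter fun j => c j = 1 / 2).card : ℝ) / 2 := by
    rw [Finset.card_filter, Nat.cast_sum, Finset.sum_div]
    refine Finset.sum_congr rfl fun j _ => ?_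
    rcases hc j with h | h <;> norm_num [h]
  have hcard (i : Fin m) : 0 < ((Iic i).filter fun j => c j = 1 / 2).card :=
    Finset.card_pos.2 ⟨⟨0, hm⟩, by simp [hc1, Fin.le_def]⟩
  have hlint := lintegral_prod_rpow_openOrderedSimplex c
    (fun i => by rw [hsum]; exact half_pos (Nat.cast_pos.2 (hcard i))) one_pos
  have hnonneg : 0 ≤ᵐ[volume.restrict (openOrderedSimplex m 1)]
      fun t : Fin m → ℝ => ∏ i, t i ^ (-(c i)) := by
    filter_upwards [ae_restrict_mem (measurableSet_openOrderedSimplex m 1)] with t ht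
    exact prod_nonneg fun i _ => Real.rpow_nonneg (ht.2.1 i).le _
  have hmeas := (measurable_prod_rpow c).aestronglyMeasurable
    (μ := volume.restrict (openOrderedSimplex m 1))
  change IntegrableOn _ (openOrderedSimplex m 1) volume ∧
    ∫ t in openOrderedSimplex m 1, _ = _
  refine ⟨⟨hmeas, ?_⟩, ?_⟩
  · rw [hasFiniteIntegral_iff_ofReal hnonneg, hlint]
    exact ENNReal.ofReal_lt_top
  · rw [integral_eq_lintegral_of_nonneg_ae hnonneg hmeas, hlint, ENNReal.toReal_ofReal]
    · have hone : (univ.filter fun i => c i = 1) = univ.filter fun i => ¬ c i = 1 / 2 := by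
        refine Finset.filter_congr fun i _ => ?_
        rcases hc i with h | h <;> norm_num [h]
      rw [hone, ← Fin.prod_card_filter_Iic fun j => c j = 1 / 2, Real.one_rpow, one_mul,
        Nat.cast_prod, one_div, ← Finset.prod_inv_distrib, mul_assoc]
      simp only [one_div (Nat.cast _), hsum, inv_div]
      rw [Finset.prod_filter_mul_prod_filter_not]
      simp [div_eq_mul_inv, Finset.prod_mul_distrib]
    · exact mul_nonneg (by simp) (prod_nonneg fun i _ => by rw [hsum]; positivity)
end

section
/- Let R > 0, let F be analytic on the disc B(0,R) ⊂ ℂ with Taylor expansion F(ξ) = Σ_{n≥0} b_n ξ^n, let 0 < a < R, let θ ∈ ℝ, and let δ > 0. Then for every integer N ≥ 0 there exists a constant C_N > 0 such that for every h ∈ ℂ \ {0} with Re(e^{iθ}/h) ≥ δ/|h|, one has | ∫_0^{a e^{iθ}} e^{−ξ/h} F(ξ) dξ − Σ_{n=0}^{N} n! · b_n · h^{n+1} | ≤ C_N |h|^{N+2}, the integral being taken along the straight segment from 0 to a·e^{iθ}. That is, the incomplete Laplace transform of F in the direction e^{iθ} admits Σ_{n≥0} n! b_n h^{n+1} as an asymptotic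 power series expansion at h = 0 on the region {h : Re(e^{iθ}/h) ≥ δ/|h|}. -/
open Complex Filter MeasureTheory Metric Set Topology
open scoped Real Nat

/-- For `0 < r.re`, the moments of the exponential weight are integrable on `(0, ∞)`. -/
lemma integrableOn_pow_mul_exp_neg_mul (n : ℕ) {r : ℂ} (hr : 0 < r.re) :
    IntegrableOn (fun t : ℝ => (t : ℂ) ^ n * Complex.exp (-(r * t))) (Ioi 0) := by
  have hint : IntegrableOn (fun t : ℝ => t ^ n * Real.exp (-(r.re * t))) (Ioi 0) := by
    refine Integrable.of_integral_ne_zero ?_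
    have h := Real.integral_rpow_mul_exp_neg_mul_Ioi (a := n + 1) (by positivity) hr
    simp only [add_sub_cancel_right, Real.rpow_natCast] at h
    rw [h]
    have := Real.Gamma_pos_of_pos (s := (n : ℝ) + 1) (by positivity)
    positivity
  refine Integrable.mono' hint (by fun_prop) ?_
  filter_upwards [ae_restrict_mem measurableSet_Ioi] with t ht
  rw [norm_mul, norm_pow, Complex.norm_exp, Complex.norm_of_nonneg (le_of_lt ht)]
  simp

/-- The Laplace transform of a monomial. -/
lemma integral_pow_mul_exp_neg_mul (n : ℕ) {r : ℂ} (hr : 0 < r.re) :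
    ∫ t : ℝ in Ioi 0, (t : ℂ) ^ n * Complex.exp (-(r * t)) = n.factorial / r ^ (n + 1) := by
  have hr0 : r ≠ 0 := by
    rintro rfl
    simp at hr
  have hexp : ∀ t : ℝ, HasDerivAt (fun t : ℝ => Complex.exp (-(r * t)))
      (Complex.exp (-(r * t)) * -(r * 1)) t := fun t =>
    ((((hasDerivAt_id (t : ℂ)).const_mul r).neg).cexp).comp_ofReal
  induction n with
  | zero =>
    have hint := integrableOn_pow_mul_exp_neg_mul 0 hr
    simp only [pow_zero, one_mul] at hint
    have hderiv : IntegrableOn (fun t : ℝ => Complex.exp (-(r * t)) * -(r * 1)) (Ioi 0) :=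
      hint.mul_const _
    have h := integral_Ioi_of_hasDerivAt_of_tendsto' (fun t _ => hexp t) hderiv
      (tendsto_zero_of_hasDerivAt_of_integrableOn_Ioi (fun t _ => hexp t) hderiv hint)
    rw [integral_mul_const] at h
    simp only [mul_one, ofReal_zero, mul_zero, neg_zero, Complex.exp_zero, zero_sub] at h
    simp only [pow_zero, one_mul, Nat.factorial_zero, Nat.cast_one, zero_add, pow_one]
    rw [eq_div_iff hr0]
    linear_combination -h
  | succ n ih =>
    have hint := integrableOn_pow_mul_exp_neg_mul n hr
    have hint' := integrableOn_pow_mul_exp_neg_mul (n + 1) hr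
    have hf : ∀ t : ℝ, HasDerivAt (fun t : ℝ => (t : ℂ) ^ (n + 1) * Complex.exp (-(r * t)))
        ((n + 1) * ((t : ℂ) ^ n * Complex.exp (-(r * t))) -
          r * ((t : ℂ) ^ (n + 1) * Complex.exp (-(r * t)))) t := by
      intro t
      have hpow : HasDerivAt (fun t : ℝ => (t : ℂ) ^ (n + 1)) (((n + 1 : ℕ) : ℂ) * (t : ℂ) ^ n) t :=
        (hasDerivAt_pow (n + 1) (t : ℂ)).comp_ofReal
      refine (hpow.mul (hexp t)).congr_deriv ?_
      push_cast
      ring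
    have hderiv := (hint.const_mul ((n : ℂ) + 1)).sub (hint'.const_mul r)
    have h := integral_Ioi_of_hasDerivAt_of_tendsto' (fun t _ => hf t) hderiv
      (tendsto_zero_of_hasDerivAt_of_integrableOn_Ioi (fun t _ => hf t) hderiv hint')
    rw [integral_sub (hint.const_mul _) (hint'.const_mul _), integral_const_mul,
      integral_const_mul, ih] at h
    simp only [ofReal_zero, ne_eq, Nat.add_eq_zero_iff, one_ne_zero, and_false, not_false_eq_true,
      zero_pow, zero_mul, sub_zero, sub_eq_zero] at h
    rw [← mul_right_inj' hr0, ← h, Nat.factorial_succ]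
    push_cast
    field_simp
    ring

/-- The real Laplace transform of a monomial. -/
lemma integral_real_pow_mul_exp_neg_mul (n : ℕ) {r : ℝ} (hr : 0 < r) :
    ∫ t : ℝ in Ioi 0, t ^ n * Real.exp (-(r * t)) = n.factorial / r ^ (n + 1) := by
  have h := Real.integral_rpow_mul_exp_neg_mul_Ioi (a := n + 1) (by positivity) hr
  simp only [add_sub_cancel_right, Real.rpow_natCast, Real.Gamma_nat_eq_factorial] at h
  rw [h, ← Nat.cast_succ, Real.rpow_natCast, one_div, inv_pow, Nat.succ_eq_add_one]
  ring

/-- A Watson-type bound: if `‖D t‖ ≤ K t ^ m` then its Laplace transform at `r` is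
`O(c⁻¹ ^ (m + 1))` whenever `c ≤ r.re`. -/
lemma norm_integral_mul_exp_neg_mul_le {D : ℝ → ℂ} {K c : ℝ} {m : ℕ} {r : ℂ} (hc : 0 < c)
    (hcr : c ≤ r.re) (hD : ∀ t, 0 < t → ‖D t‖ ≤ K * t ^ m) :
    ‖∫ t : ℝ in Ioi 0, D t * Complex.exp (-(r * t))‖ ≤ K * (m.factorial / c ^ (m + 1)) := by
  have hI := integral_real_pow_mul_exp_neg_mul m hc
  rw [← hI, ← integral_const_mul]
  refine norm_integral_le_of_norm_le (Integrable.const_mul ?_ K) ?_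
  · refine Integrable.of_integral_ne_zero ?_
    rw [hI]
    positivity
  · filter_upwards [ae_restrict_mem measurableSet_Ioi] with t ht
    have ht : 0 < t := ht
    rw [norm_mul, Complex.norm_exp, ← mul_assoc]
    refine mul_le_mul (hD t ht) (Real.exp_le_exp.2 ?_) (Real.exp_pos _).le
      ((norm_nonneg _).trans (hD t ht))
    simpa using mul_le_mul_of_nonneg_right hcr ht.le

lemma summable_norm_coeff_mul_pow {R : ℝ} {F : ℂ → ℂ} {b : ℕ → ℂ}
    (hF : ∀ ξ : ℂ, ‖ξ‖ < R → HasSum (fun n : ℕ => b n * ξ ^ n) (F ξ))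
    {a : ℝ} (ha0 : 0 < a) (haR : a < R) : Summable fun n => ‖b n‖ * a ^ n := by
  have h := (hF (a : ℂ) (by rwa [Complex.norm_of_nonneg ha0.le])).summable.norm
  simpa [abs_of_pos ha0] using h

lemma continuousOn_closedBall_of_hasSum {R : ℝ} {F : ℂ → ℂ} {b : ℕ → ℂ}
    (hF : ∀ ξ : ℂ, ‖ξ‖ < R → HasSum (fun n : ℕ => b n * ξ ^ n) (F ξ))
    {a : ℝ} (ha0 : 0 < a) (haR : a < R) : ContinuousOn F (closedBall 0 a) := by
  have h : ContinuousOn (fun ξ : ℂ => ∑' n, b n * ξ ^ n) (closedBall 0 a) := by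
    refine continuousOn_tsum (fun n => by fun_prop) (summable_norm_coeff_mul_pow hF ha0 haR) ?_
    intro n ξ hξ
    rw [mem_closedBall_zero_iff] at hξ
    rw [norm_mul, norm_pow]
    gcongr
  refine h.congr fun ξ hξ => (hF ξ ?_).tsum_eq.symm
  exact (mem_closedBall_zero_iff.1 hξ).trans_lt haR

/-- Taylor remainder bound for a convergent power series. -/
lemma norm_sub_sum_range_le {R : ℝ} {F : ℂ → ℂ} {b : ℕ → ℂ}
    (hF : ∀ ξ : ℂ, ‖ξ‖ < R → HasSum (fun n : ℕ => b n * ξ ^ n) (F ξ))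
    {a : ℝ} (ha0 : 0 < a) (haR : a < R) (m : ℕ) {ξ : ℂ} (hξ : ‖ξ‖ ≤ a) :
    ‖F ξ - ∑ n ∈ Finset.range m, b n * ξ ^ n‖ ≤ (∑' n, ‖b n‖ * a ^ n) / a ^ m * ‖ξ‖ ^ m := by
  have hs := summable_norm_coeff_mul_pow hF ha0 haR
  have hξs := hF ξ (hξ.trans_lt haR)
  rw [← hξs.tsum_eq, ← hξs.summable.sum_add_tsum_nat_add m, add_sub_cancel_left]
  have hs' := (summable_nat_add_iff m).2 hs
  have hbound : ∀ n, ‖b (n + m) * ξ ^ (n + m)‖ ≤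
      (‖b (n + m)‖ * a ^ (n + m)) * (‖ξ‖ ^ m / a ^ m) := by
    intro n
    rw [norm_mul, norm_pow, pow_add, pow_add,
      show ‖b (n + m)‖ * (a ^ n * a ^ m) * (‖ξ‖ ^ m / a ^ m) = ‖b (n + m)‖ * (a ^ n * ‖ξ‖ ^ m) by
        field_simp]
    gcongr
  refine (tsum_of_norm_bounded (hs'.mul_right _).hasSum hbound).trans ?_
  rw [tsum_mul_right, div_mul_eq_mul_div, ← mul_div_assoc]
  have h := hs.sum_add_tsum_nat_add m
  have h0 : 0 ≤ ∑ n ∈ Finset.range m, ‖b n‖ * a ^ n := Finset.sum_nonneg fun n _ => by positivity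
  have hle : ∑' n, ‖b (n + m)‖ * a ^ (n + m) ≤ ∑' n, ‖b n‖ * a ^ n := by linarith
  exact div_le_div_of_nonneg_right (mul_le_mul_of_nonneg_right hle (by positivity)) (by positivity)

/-- A polynomial of degree less than `m` is dominated by its `m`-th power outside a disc. -/
lemma norm_sum_range_le {b : ℕ → ℂ} {a : ℝ} (ha0 : 0 < a) (hs : Summable fun n => ‖b n‖ * a ^ n)
    (m : ℕ) {ξ : ℂ} (hξ : a ≤ ‖ξ‖) :
    ‖∑ n ∈ Finset.range m, b n * ξ ^ n‖ ≤ (∑' n, ‖b n‖ * a ^ n) / a ^ m * ‖ξ‖ ^ m := by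
  calc ‖∑ n ∈ Finset.range m, b n * ξ ^ n‖
      ≤ ∑ n ∈ Finset.range m, ‖b n‖ * a ^ n * (‖ξ‖ / a) ^ m := by
        refine norm_sum_le_of_le _ fun n hn => ?_
        have h1 : (‖ξ‖ / a) ^ n ≤ (‖ξ‖ / a) ^ m :=
          pow_le_pow_right₀ ((one_le_div ha0).2 hξ) (Finset.mem_range.1 hn).le
        calc ‖b n * ξ ^ n‖ = ‖b n‖ * a ^ n * (‖ξ‖ / a) ^ n := by
              rw [norm_mul, norm_pow, div_pow]
              field_simp
          _ ≤ _ := by gcongr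
    _ = (∑ n ∈ Finset.range m, ‖b n‖ * a ^ n) * (‖ξ‖ / a) ^ m := by rw [Finset.sum_mul]
    _ ≤ (∑' n, ‖b n‖ * a ^ n) * (‖ξ‖ / a) ^ m := by
        gcongr
        exact hs.sum_le_tsum _ fun n _ => by positivity
    _ = _ := by rw [div_pow]; ring

/-- The incomplete Laplace transform `∫_0^{a e^{iθ}} e^{-ξ/h} F(ξ) dξ` of a function
`F` analytic on `B(0,R)` with Taylor coefficients `b_n` admits
`Σ_n n! b_n h^{n+1}` as an asymptotic power series expansion at `h = 0` on the region
`{h : Re(e^{iθ}/h) ≥ δ/|h|}`. -/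
theorem stmt18 (R : ℝ) (hR : 0 < R) (F : ℂ → ℂ) (b : ℕ → ℂ)
    (hF : ∀ ξ : ℂ, ‖ξ‖ < R → HasSum (fun n : ℕ => b n * ξ ^ n) (F ξ))
    (a : ℝ) (ha0 : 0 < a) (haR : a < R) (θ : ℝ) (δ : ℝ) (hδ : 0 < δ) :
    ∀ N : ℕ, ∃ C : ℝ, 0 < C ∧ ∀ h : ℂ, h ≠ 0 →
      δ / ‖h‖ ≤ (Complex.exp (Complex.I * (θ : ℂ)) / h).re →
      ‖(∫ t in (0:ℝ)..a,
            Complex.exp (-((t : ℂ) * Complex.exp (Complex.I * (θ : ℂ))) / h) *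
              F ((t : ℂ) * Complex.exp (Complex.I * (θ : ℂ))) *
              Complex.exp (Complex.I * (θ : ℂ))) -
          ∑ n ∈ Finset.range (N + 1), ((n.factorial : ℕ) : ℂ) * b n * h ^ (n + 1)‖
        ≤ C * ‖h‖ ^ (N + 2) := by
  intro N
  have hs := summable_norm_coeff_mul_pow hF ha0 haR
  have he : ‖Complex.exp (Complex.I * (θ : ℂ))‖ = 1 := by
    rw [mul_comm, Complex.norm_exp_ofReal_mul_I]
  have he0 := Complex.exp_ne_zero (Complex.I * (θ : ℂ))
  generalize Complex.exp (Complex.I * (θ : ℂ)) = e at he he0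
  set M := (∑' n, ‖b n‖ * a ^ n) / a ^ (N + 1)
  have hM0 : 0 ≤ M := div_nonneg (tsum_nonneg fun n => by positivity) (by positivity)
  refine ⟨(M + 1) * ((N + 1).factorial / δ ^ (N + 2)), by positivity, fun h hh hre => ?_⟩
  have hc : 0 < δ / ‖h‖ := div_pos hδ (norm_pos_iff.2 hh)
  have hr : 0 < (e / h).re := hc.trans_le hre
  have hnorm : ∀ t : ℝ, 0 < t → ‖(t : ℂ) * e‖ = t := fun t ht => by
    rw [norm_mul, he, mul_one, Complex.norm_of_nonneg ht.le]
  set G : ℝ → ℂ := (Ioc 0 a).indicator fun t => F (t * e) * e with hG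
  set P : ℝ → ℂ := fun t => (∑ n ∈ Finset.range (N + 1), b n * (t * e) ^ n) * e with hP
  have hGP : ∀ t, 0 < t → ‖G t - P t‖ ≤ M * t ^ (N + 1) := by
    intro t ht
    rcases le_or_gt t a with hta | hta
    · rw [hG, indicator_of_mem (show t ∈ Ioc 0 a from ⟨ht, hta⟩), hP, ← sub_mul, norm_mul, he,
        mul_one]
      simpa only [hnorm t ht] using
        norm_sub_sum_range_le hF ha0 haR (N + 1) ((hnorm t ht).trans_le hta)
    · rw [hG, indicator_of_notMem (fun h => hta.not_ge h.2), zero_sub, norm_neg, hP, norm_mul, he,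
        mul_one]
      simpa only [hnorm t ht] using
        norm_sum_range_le ha0 hs (N + 1) (hta.le.trans_eq (hnorm t ht).symm)
  have hPexp : ∀ t : ℝ, P t * Complex.exp (-(e / h * t)) = ∑ n ∈ Finset.range (N + 1),
      b n * e ^ (n + 1) * ((t : ℂ) ^ n * Complex.exp (-(e / h * t))) := by
    intro t
    rw [hP]
    simp only [Finset.sum_mul]
    exact Finset.sum_congr rfl fun n _ => by ring
  have hPint : IntegrableOn (fun t : ℝ => P t * Complex.exp (-(e / h * t))) (Ioi 0) := by
    simp only [hPexp]
    exact integrable_finsetSum _ fun n _ => (integrableOn_pow_mul_exp_neg_mul n hr).const_mul _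
  have hPeq : ∫ t : ℝ in Ioi 0, P t * Complex.exp (-(e / h * t)) =
      ∑ n ∈ Finset.range (N + 1), ((n.factorial : ℕ) : ℂ) * b n * h ^ (n + 1) := by
    simp only [hPexp]
    rw [integral_finsetSum _ fun n _ => (integrableOn_pow_mul_exp_neg_mul n hr).const_mul _]
    refine Finset.sum_congr rfl fun n _ => ?_
    rw [integral_const_mul, integral_pow_mul_exp_neg_mul n hr, div_pow]
    field_simp
  have hGexp : (fun t : ℝ => G t * Complex.exp (-(e / h * t))) = (Ioc 0 a).indicator
      fun t : ℝ => Complex.exp (-((t : ℂ) * e) / h) * F (t * e) * e := by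
    ext t
    rw [hG, show -(e / h * t) = -((t : ℂ) * e) / h by ring]
    by_cases ht : t ∈ Ioc 0 a
    · rw [indicator_of_mem ht, indicator_of_mem ht]
      ring
    · rw [indicator_of_notMem ht, indicator_of_notMem ht, zero_mul]
  have hcont : ContinuousOn (fun t : ℝ => Complex.exp (-((t : ℂ) * e) / h) * F (t * e) * e)
      (Icc 0 a) := by
    have hFc : ContinuousOn (fun t : ℝ => F (t * e)) (Icc 0 a) := by
      refine (continuousOn_closedBall_of_hasSum hF ha0 haR).comp (by fun_prop) fun t ht => ?_
      rw [mem_closedBall_zero_iff, norm_mul, he, mul_one, Complex.norm_of_nonneg ht.1]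
      exact ht.2
    have hexp : Continuous fun t : ℝ => Complex.exp (-((t : ℂ) * e) / h) := by fun_prop
    exact (hexp.continuousOn.mul hFc).mul continuousOn_const
  have hGint : IntegrableOn (fun t : ℝ => G t * Complex.exp (-(e / h * t))) (Ioi 0) := by
    rw [hGexp]
    exact ((integrable_indicator_iff measurableSet_Ioc).2
      (hcont.integrableOn_Icc.mono_set Ioc_subset_Icc_self)).integrableOn
  have hGeq : ∫ t : ℝ in Ioi 0, G t * Complex.exp (-(e / h * t)) =
      ∫ t in (0:ℝ)..a, Complex.exp (-((t : ℂ) * e) / h) * F (t * e) * e := by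
    rw [hGexp, setIntegral_indicator measurableSet_Ioc, intervalIntegral.integral_of_le ha0.le,
      inter_eq_right.2 Ioc_subset_Ioi_self]
  rw [← hPeq, ← hGeq, ← integral_sub hGint hPint]
  simp only [← sub_mul]
  refine (norm_integral_mul_exp_neg_mul_le hc hre hGP).trans ?_
  rw [div_pow, show M * (((N + 1).factorial : ℝ) / (δ ^ (N + 1 + 1) / ‖h‖ ^ (N + 1 + 1))) =
    M * ((N + 1).factorial / δ ^ (N + 2)) * ‖h‖ ^ (N + 2) by rw [div_div_eq_mul_div]; ring]
  gcongr
  linarith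
end
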